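/- Let A be an abelian length category and X, Y indecomposable with X a Gabriel-Roiter predecessor of Y. If X → X̄ is a left almost split morphism in A, then Y is a quotient (epimorphic image) of X̄. -/

import Mathlib

open CategoryTheory CategoryTheory.Limits

/-- The lexicographic order on finite subsets of ℕ:
`X ≤ Y` iff `min (Y \ X) ≤ min (X \ Y)`, with `min ∅ = ⊤`. -/
def lexLE (X Y : Finset ℕ) : Prop :=
  (Y \ X).min ≤ (X \ Y).min

/-- Strict lexicographic order. -/
def lexLT (X Y : Finset ℕ) : Prop :=
  lexLE X Y ∧ ¬ lexLE Y X

variable {C : Type*} [Category C] [Abelian C]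

/-- `n` is the composition length of the object `X`: there is a maximal
strictly increasing chain of subobjects of `X` from `⊥` to `⊤` with `n`
steps, and every strictly increasing chain of subobjects has at most
`n` steps. -/
def ObjLength (X : C) (n : ℕ) : Prop :=
  (∃ f : Fin (n + 1) → Subobject X, StrictMono f ∧ f 0 = ⊥ ∧ f (Fin.last n) = ⊤) ∧
  ∀ (m : ℕ) (f : Fin (m + 1) → Subobject X), StrictMono f → m ≤ n

/-- `A` is the set of lengths of a finite chain of indecomposable subobjects
of `X` ending in `X` itself. -/
def IsGRChainVal (len : C → ℕ) (X : C) (A : Finset ℕ) : Prop :=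
  ∃ s : Finset (Subobject X),
    IsChain (· ≤ ·) (s : Set (Subobject X)) ∧
    (⊤ : Subobject X) ∈ s ∧
    (∀ t ∈ s, Indecomposable ((t : Subobject X) : C)) ∧
    s.image (fun t : Subobject X => len ((t : Subobject X) : C)) = A

/-- `mu` is the Gabriel-Roiter measure associated to the length function
`len`: for each indecomposable `X`, `mu X` is the lexicographic maximum of
the sets of lengths along chains of indecomposable subobjects of `X`. -/
def IsGRMeasure (len : C → ℕ) (mu : C → Finset ℕ) : Prop :=
  ∀ X : C, Indecomposable X →
    IsGRChainVal len X (mu X) ∧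
    ∀ A : Finset ℕ, IsGRChainVal len X A → lexLE A (mu X)

/-- `X` is a Gabriel-Roiter predecessor of `Y`: both are indecomposable,
`X` is a proper subobject of `Y`, and `mu X` attains the maximum of the
Gabriel-Roiter measures of the proper indecomposable subobjects of `Y`. -/
def IsGRPred (mu : C → Finset ℕ) (X Y : C) : Prop :=
  Indecomposable X ∧ Indecomposable Y ∧
  (∃ f : X ⟶ Y, Mono f ∧ ¬ IsIso f) ∧
  ∀ t : Subobject Y, t ≠ ⊤ → Indecomposable ((t : Subobject Y) : C) →
    lexLE (mu ((t : Subobject Y) : C)) (mu X)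

theorem lexLE_iff' (A B : Finset ℕ) :
    lexLE A B ↔ ∀ a ∈ A, a ∉ B → ∃ b ∈ B, b ∉ A ∧ b < a := by
  unfold lexLE
  constructor
  · intro h a ha hb
    have h1 : (A \ B).min ≤ a := Finset.min_le (by simp [ha, hb])
    have h2 := h.trans h1
    obtain ⟨b, hb'⟩ := WithTop.ne_top_iff_exists.1 (ne_top_of_le_ne_top (WithTop.coe_ne_top) h2)
    have h3 := Finset.mem_of_min hb'.symm
    rw [← hb'] at h2
    have h4 : b ≤ a := WithTop.coe_le_coe.1 h2
    rw [Finset.mem_sdiff] at h3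
    refine ⟨b, h3.1, h3.2, lt_of_le_of_ne h4 ?_⟩
    rintro rfl
    exact hb h3.1
  · intro h
    refine Finset.le_min ?_
    intro a ha
    rw [Finset.mem_sdiff] at ha
    obtain ⟨b, hb, hb', hlt⟩ := h a ha.1 ha.2
    exact (Finset.min_le (a := b) (by simp [hb, hb'])).trans (WithTop.coe_le_coe.2 hlt.le)

theorem lexLE_trans' {A B D : Finset ℕ} (h1 : lexLE A B) (h2 : lexLE B D) : lexLE A D := by
  classical
  rw [lexLE_iff'] at *
  intro a ha had
  have hex : ∃ d, ¬ ((d ∈ A ↔ d ∈ B) ∧ (d ∈ B ↔ d ∈ D)) := ⟨a, by tauto⟩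
  have hd := Nat.find_spec hex
  have hda : Nat.find hex ≤ a := Nat.find_min' hex (by tauto)
  have hmin : ∀ m < Nat.find hex, ((m ∈ A ↔ m ∈ B) ∧ (m ∈ B ↔ m ∈ D)) := by
    intro m hm
    have := Nat.find_min hex hm
    tauto
  generalize Nat.find hex = d at *
  have e1 : d ∈ A → d ∈ B := by
    intro hA
    by_contra hB
    obtain ⟨b, hb, hb', hlt⟩ := h1 d hA hB
    have := hmin b hlt
    tauto
  have e2 : d ∈ B → d ∈ D := by
    intro hA
    by_contra hB
    obtain ⟨b, hb, hb', hlt⟩ := h2 d hA hB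
    have := hmin b hlt
    tauto
  refine ⟨d, by tauto, by tauto, lt_of_le_of_ne hda ?_⟩
  rintro rfl
  tauto

theorem lexLE_insert_self (A : Finset ℕ) (n : ℕ) : lexLE A (insert n A) := by
  rw [lexLE_iff']
  intro a ha h
  simp [ha] at h

theorem lex_comb {B M S : Finset ℕ} {n : ℕ} (hB : ∀ b ∈ B, b < n)
    (h1 : lexLE B (insert n S)) (h2 : lexLE S M) : lexLE B M := by
  refine lexLE_trans' ?_ h2
  rw [lexLE_iff'] at *
  intro a ha hS
  have := hB a ha
  obtain ⟨b, hb, hb', hlt⟩ := h1 a ha (by simp [hS]; omega)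
  refine ⟨b, ?_, hb', hlt⟩
  rw [Finset.mem_insert] at hb
  rcases hb with rfl | hb
  · omega
  · exact hb

theorem indec_of_iso {X Y : C} (e : X ≅ Y) (h : Indecomposable X) : Indecomposable Y :=
  ⟨fun hz => h.1 (hz.of_iso e), fun A B i => h.2 A B (e ≪≫ i)⟩

theorem isIso_of_retract {X Y : C} (hY : Indecomposable Y) (hX : ¬ IsZero X)
    (j : X ⟶ Y) (r : Y ⟶ X) (h : j ≫ r = 𝟙 X) : IsIso j := by
  have hs : IsSplitMono j := ⟨⟨⟨r, h⟩⟩⟩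
  have hb := isBilimitBinaryBiconeOfIsSplitMonoOfCokernel (cokernelIsCokernel j)
  have e : Y ≅ X ⊞ cokernel j := biprod.uniqueUpToIso _ _ hb
  rcases hY.2 _ _ e with h0 | h0
  · exact absurd h0 hX
  · have : Epi j := Preadditive.epi_of_cokernel_zero (h0.eq_of_tgt _ _)
    exact isIso_of_mono_of_epi j


theorem map_strictMono {X Y : C} (f : X ⟶ Y) [Mono f] :
    StrictMono (Subobject.map f).obj :=
  (Subobject.map f).monotone.strictMono_of_injective (Subobject.map_obj_injective f)

theorem len_le_of_mono {len : C → ℕ} (hlen : ∀ Z : C, ObjLength Z (len Z))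
    {X Y : C} (f : X ⟶ Y) [Mono f] : len X ≤ len Y := by
  obtain ⟨⟨c, hc, -, -⟩, -⟩ := hlen X
  exact (hlen Y).2 _ (fun i => (Subobject.map f).obj (c i)) ((map_strictMono f).comp hc)

theorem len_lt_of_mono {len : C → ℕ} (hlen : ∀ Z : C, ObjLength Z (len Z))
    {X Y : C} (f : X ⟶ Y) [Mono f] (hf : ¬ IsIso f) : len X < len Y := by
  obtain ⟨⟨c, hc, -, htop⟩, -⟩ := hlen X
  have hm : StrictMono (fun i => (Subobject.map f).obj (c i)) := (map_strictMono f).comp hc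
  refine (hlen Y).2 _ (Fin.snoc (α := fun _ => Subobject Y)
    (fun i => (Subobject.map f).obj (c i)) ⊤) ?_
  rw [Fin.strictMono_iff_lt_succ]
  intro i
  refine Fin.lastCases ?_ (fun i => ?_) i
  · rw [Fin.succ_last, Fin.snoc_last, Fin.snoc_castSucc, htop, lt_top_iff_ne_top]
    intro h
    rw [Subobject.top_eq_id, Subobject.map_mk, ← Subobject.isIso_iff_mk_eq_top] at h
    rw [Category.id_comp] at h
    exact hf h
  · rw [Fin.snoc_castSucc, Fin.succ_castSucc, Fin.snoc_castSucc]
    exact hm (Fin.castSucc_lt_succ)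

theorem len_eq_of_iso {len : C → ℕ} (hlen : ∀ Z : C, ObjLength Z (len Z))
    {X Y : C} (e : X ≅ Y) : len X = len Y :=
  le_antisymm (len_le_of_mono hlen e.hom) (len_le_of_mono hlen e.inv)

theorem pullback_le_of_epi {X Y : C} (p : X ⟶ Y) [Epi p] {a b : Subobject Y}
    (h : (Subobject.pullback p).obj b ≤ (Subobject.pullback p).obj a) : b ≤ a := by
  have ha := Subobject.isPullback p a
  have hb := Subobject.isPullback p b
  have : Epi (Subobject.pullbackπ p b) := by
    rw [← hb.isoPullback_hom_fst]
    infer_instance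
  have : StrongEpi (Subobject.pullbackπ p b) := strongEpi_of_epi _
  have sq : CommSq (Subobject.ofLE _ _ h ≫ Subobject.pullbackπ p a) (Subobject.pullbackπ p b)
      a.arrow b.arrow := ⟨by simp [ha.w, hb.w]⟩
  exact Subobject.le_of_comm sq.lift sq.fac_right

theorem len_lt_of_epi {len : C → ℕ} (hlen : ∀ Z : C, ObjLength Z (len Z))
    {X Y : C} (p : X ⟶ Y) [Epi p] (hp : ¬ Mono p) : len Y < len X := by
  obtain ⟨⟨c, hc, hbot, -⟩, -⟩ := hlen Y
  have hs : StrictMono (Subobject.pullback p).obj := by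
    intro a b hab
    exact lt_of_le_not_ge ((Subobject.pullback p).monotone hab.le)
      (fun h => hab.not_ge (pullback_le_of_epi p h))
  have hm : StrictMono (fun i => (Subobject.pullback p).obj (c i)) := hs.comp hc
  refine (hlen X).2 _ (Fin.cons (α := fun _ => Subobject X) ⊥
    (fun i => (Subobject.pullback p).obj (c i))) ?_
  rw [Fin.strictMono_iff_lt_succ]
  intro i
  refine Fin.cases ?_ (fun i => ?_) i
  · rw [Fin.castSucc_zero, Fin.cons_zero, Fin.cons_succ, hbot, bot_lt_iff_ne_bot]
    intro h
    apply hp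
    refine Preadditive.mono_of_cancel_zero _ fun {T} g hg => ?_
    have hpb := Subobject.isPullback p ⊥
    have hw : (0 : T ⟶ _) ≫ (⊥ : Subobject Y).arrow = g ≫ p := by simp [hg]
    have := hpb.lift_snd 0 g hw
    have h0 : ((Subobject.pullback p).obj ⊥).arrow = 0 := by
      rw [h]
      exact Subobject.bot_arrow
    generalize hpb.lift 0 g hw = l at this
    rw [← this, h0, comp_zero]
  · rw [Fin.cons_succ, ← Fin.succ_castSucc, Fin.cons_succ]
    exact hm (Fin.castSucc_lt_succ)

theorem exists_indec_retract {len : C → ℕ} (hlen : ∀ Z : C, ObjLength Z (len Z)) (n : ℕ) :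
    ∀ (I T : C) (g : T ⟶ I), len I = n → g ≠ 0 →
      ∃ (Y : C) (p : I ⟶ Y) (s : Y ⟶ I), Indecomposable Y ∧ s ≫ p = 𝟙 Y ∧ g ≫ p ≠ 0 := by
  induction n using Nat.strong_induction_on with
  | _ n ih =>
    intro I T g hn hg
    by_cases hI : Indecomposable I
    · exact ⟨I, 𝟙 I, 𝟙 I, hI, by simp, by simpa using hg⟩
    have hz : ¬ IsZero I := fun h => hg (h.eq_of_tgt _ _)
    have hI' : ∃ (A B : C) (e : I ≅ A ⊞ B), ¬ IsZero A ∧ ¬ IsZero B := by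
      by_contra hcon
      push Not at hcon
      exact hI ⟨hz, fun A B e => or_iff_not_imp_left.2 (hcon A B e)⟩
    obtain ⟨A, B, e, hA, hB⟩ := hI'
    have key : ∀ (D : C) (q : I ⟶ D) (t : D ⟶ I), t ≫ q = 𝟙 D → ¬ IsIso t → g ≫ q ≠ 0 →
        ∃ (Y : C) (p : I ⟶ Y) (s : Y ⟶ I), Indecomposable Y ∧ s ≫ p = 𝟙 Y ∧ g ≫ p ≠ 0 := by
      intro D q t htq ht hgq
      have : IsSplitMono t := ⟨⟨⟨q, htq⟩⟩⟩
      obtain ⟨Y, p, s, hY, hsp, hp⟩ := ih (len D) (hn ▸ len_lt_of_mono hlen t ht) D T (g ≫ q) rfl hgq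
      refine ⟨Y, q ≫ p, s ≫ t, hY, ?_, by simpa using hp⟩
      simp only [Category.assoc]
      rw [reassoc_of% htq, hsp]
    have hAB : g ≫ e.hom ≫ biprod.fst ≠ 0 ∨ g ≫ e.hom ≫ biprod.snd ≠ 0 := by
      by_contra hcon
      push Not at hcon
      apply hg
      have : g ≫ e.hom = 0 := by
        apply biprod.hom_ext <;> simp [hcon]
      simpa using this =≫ e.inv
    rcases hAB with h | h
    · refine key A (e.hom ≫ biprod.fst) (biprod.inl ≫ e.inv) (by simp) ?_ h
      intro hi
      apply hB
      have : IsIso (biprod.inl : A ⟶ A ⊞ B) := IsIso.of_isIso_comp_right _ e.inv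
      exact (Biprod.isIso_inl_iff_isZero A B).1 this
    · refine key B (e.hom ≫ biprod.snd) (biprod.inr ≫ e.inv) (by simp) ?_ h
      intro hi
      apply hA
      have : IsIso (biprod.inr : B ⟶ A ⊞ B) := IsIso.of_isIso_comp_right _ e.inv
      rw [IsZero.iff_id_eq_zero]
      have h1 : (biprod.fst : A ⊞ B ⟶ A) = 0 := by
        rw [← cancel_epi (biprod.inr : B ⟶ A ⊞ B)]; simp
      rw [← biprod.inl_fst (X := A) (Y := B), h1, comp_zero]

section GR
variable {len : C → ℕ} {mu : C → Finset ℕ}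

theorem mu_le_len (hlen : ∀ Z : C, ObjLength Z (len Z)) (hmu : IsGRMeasure len mu)
    {X : C} (hX : Indecomposable X) : ∀ a ∈ mu X, a ≤ len X := by
  obtain ⟨⟨s, -, -, -, hs⟩, -⟩ := hmu X hX
  intro a ha
  rw [← hs, Finset.mem_image] at ha
  obtain ⟨t, -, rfl⟩ := ha
  exact len_le_of_mono hlen t.arrow

theorem len_mem_mu (hlen : ∀ Z : C, ObjLength Z (len Z)) (hmu : IsGRMeasure len mu)
    {X : C} (hX : Indecomposable X) : len X ∈ mu X := by
  obtain ⟨⟨s, -, htop, -, hs⟩, -⟩ := hmu X hX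
  rw [← hs, Finset.mem_image]
  exact ⟨⊤, htop, len_eq_of_iso hlen (asIso (⊤ : Subobject X).arrow)⟩

theorem exists_map_iso {X Y : C} (f : X ⟶ Y) [Mono f] (t : Subobject X) :
    Nonempty ((t : C) ≅ (((Subobject.map f).obj t : Subobject Y) : C)) := by
  have h : (Subobject.map f).obj t = Subobject.mk (t.arrow ≫ f) := by
    conv_lhs => rw [← Subobject.mk_arrow t]
    exact Subobject.map_mk _ _
  exact ⟨(Subobject.isoOfEqMk _ _ h).symm⟩

theorem insert_le_mu (hlen : ∀ Z : C, ObjLength Z (len Z)) (hmu : IsGRMeasure len mu)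
    {Z W : C} (hZ : Indecomposable Z) (hW : Indecomposable W) (f : Z ⟶ W) [Mono f] :
    lexLE (insert (len W) (mu Z)) (mu W) := by
  classical
  obtain ⟨⟨s, hch, -, hind, hs⟩, -⟩ := hmu Z hZ
  refine (hmu W hW).2 _ ⟨insert ⊤ (s.image (Subobject.map f).obj), ?_, by simp, ?_, ?_⟩
  · rw [Finset.coe_insert, Finset.coe_image]
    refine IsChain.insert ?_ (fun b _ _ => Or.inr le_top)
    rintro _ ⟨a, ha, rfl⟩ _ ⟨b, hb, rfl⟩ hne
    rcases hch.total ha hb with h | h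
    · exact Or.inl ((Subobject.map f).monotone h)
    · exact Or.inr ((Subobject.map f).monotone h)
  · intro t ht
    rw [Finset.mem_insert, Finset.mem_image] at ht
    rcases ht with rfl | ⟨a, ha, rfl⟩
    · exact indec_of_iso (asIso (⊤ : Subobject W).arrow).symm hW
    · exact indec_of_iso (exists_map_iso f a).some (hind a ha)
  · rw [Finset.image_insert, Finset.image_image, ← hs]
    congr 1
    · exact len_eq_of_iso hlen (asIso (⊤ : Subobject W).arrow)
    · refine Finset.image_congr fun a _ => ?_
      exact (len_eq_of_iso hlen (exists_map_iso f a).some).symm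

theorem mu_mono (hlen : ∀ Z : C, ObjLength Z (len Z)) (hmu : IsGRMeasure len mu)
    {Z W : C} (hZ : Indecomposable Z) (hW : Indecomposable W) (f : Z ⟶ W) [Mono f] :
    lexLE (mu Z) (mu W) :=
  lexLE_trans' (lexLE_insert_self _ _) (insert_le_mu hlen hmu hZ hW f)

theorem isIso_of_mu_le (hlen : ∀ Z : C, ObjLength Z (len Z)) (hmu : IsGRMeasure len mu)
    {Z W : C} (hZ : Indecomposable Z) (hW : Indecomposable W) (f : Z ⟶ W) [Mono f]
    (h : lexLE (mu W) (mu Z)) : IsIso f := by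
  by_contra hf
  have hlt := len_lt_of_mono hlen f hf
  have h1 := lexLE_trans' (insert_le_mu hlen hmu hZ hW f) h
  rw [lexLE_iff'] at h1
  obtain ⟨b, hb, hb', -⟩ := h1 (len W) (by simp)
    (fun hm => by have := mu_le_len hlen hmu hZ _ hm; omega)
  simp [hb] at hb'

/-- Either `mu X = {len X}` or `mu X` is obtained from a chain ending in a proper subobject. -/
theorem exists_pred (hlen : ∀ Z : C, ObjLength Z (len Z)) (hmu : IsGRMeasure len mu)
    {X : C} (hX : Indecomposable X) :
    mu X = {len X} ∨ ∃ (X' : C) (j : X' ⟶ X) (S : Finset ℕ), Mono j ∧ ¬ IsIso j ∧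
      Indecomposable X' ∧ mu X = insert (len X) S ∧ lexLE S (mu X') := by
  classical
  obtain ⟨⟨s, hch, htop, hind, hs⟩, -⟩ := hmu X hX
  have hlt : len ((⊤ : Subobject X) : C) = len X :=
    len_eq_of_iso hlen (asIso (⊤ : Subobject X).arrow)
  have hs' : mu X = insert (len X) ((s.erase ⊤).image
      (fun t : Subobject X => len ((t : Subobject X) : C))) := by
    rw [← hs, ← hlt, ← Finset.image_insert (fun t : Subobject X => len ((t : Subobject X) : C)),
      Finset.insert_erase htop]
  by_cases hne : (s.erase ⊤).Nonempty
  swap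
  · left
    rw [hs', Finset.not_nonempty_iff_eq_empty.1 hne]
    simp
  right
  obtain ⟨t, ht⟩ := (s.erase ⊤).exists_maximal hne
  have hts := Finset.mem_erase.1 ht.1
  have hle : ∀ r ∈ s.erase ⊤, r ≤ t := by
    intro r hr
    rcases hch.total (Finset.mem_of_mem_erase hr) hts.2 with h | h
    · exact h
    · exact ht.2 hr h
  have hpb : ∀ r (h : r ≤ t),
      (Subobject.pullback t.arrow).obj r = Subobject.mk (Subobject.ofLE r t h) := by
    intro r h
    have : r = (Subobject.map t.arrow).obj (Subobject.mk (Subobject.ofLE r t h)) := by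
      rw [Subobject.map_mk]
      simp
    conv_lhs => rw [this]
    exact Subobject.pullback_map_self _ _
  have hiso : ∀ r, r ≤ t → Nonempty ((r : C) ≅ (((Subobject.pullback t.arrow).obj r : Subobject (t : C)) : C)) :=
    fun r h => ⟨(Subobject.isoOfEqMk _ _ (hpb r h)).symm⟩
  refine ⟨(t : C), t.arrow, _, inferInstance, ?_, hind t hts.2, hs', ?_⟩
  · intro h
    exact hts.1 (Subobject.eq_top_of_isIso_arrow t)
  · refine (hmu _ (hind t hts.2)).2 _
      ⟨(s.erase ⊤).image (Subobject.pullback t.arrow).obj, ?_, ?_, ?_, ?_⟩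
    · rw [Finset.coe_image]
      rintro _ ⟨a, ha, rfl⟩ _ ⟨b, hb, rfl⟩ hne
      rcases hch.total (Finset.mem_of_mem_erase ha) (Finset.mem_of_mem_erase hb) with h | h
      · exact Or.inl ((Subobject.pullback t.arrow).monotone h)
      · exact Or.inr ((Subobject.pullback t.arrow).monotone h)
    · rw [Finset.mem_image]
      refine ⟨t, ht.1, ?_⟩
      rw [hpb t le_rfl, ← Subobject.isIso_iff_mk_eq_top, Subobject.ofLE_refl]
      infer_instance
    · intro r hr
      obtain ⟨a, ha, rfl⟩ := Finset.mem_image.1 hr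
      exact indec_of_iso (hiso a (hle a ha)).some (hind a (Finset.mem_of_mem_erase ha))
    · rw [Finset.image_image]
      refine Finset.image_congr fun a ha => ?_
      exact (len_eq_of_iso hlen (hiso a (hle a ha)).some).symm

/-- Main property (Gabriel). -/
theorem main_property (hlen : ∀ Z : C, ObjLength Z (len Z)) (hmu : IsGRMeasure len mu) (n : ℕ) :
    ∀ (X : C) (Q : ∀ V : C, (X ⟶ V) → Prop), len X = n → Indecomposable X →
      (∀ (T : C) (g : T ⟶ X), (∀ V f, Q V f → g ≫ f = 0) → g = 0) →
      (∀ V f, Q V f → ∀ (Z : C) (m : Z ⟶ V), Mono m → Indecomposable Z →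
        lexLE (mu Z) (mu X)) →
      ∃ V f, Q V f ∧ Mono f := by
  induction n using Nat.strong_induction_on with
  | _ n ih =>
    intro X Q hn hX hQ hle
    by_contra hcon
    push Not at hcon
    -- the refined family of epimorphisms onto indecomposables
    let R : ∀ Y : C, (X ⟶ Y) → Prop := fun Y q =>
      Indecomposable Y ∧ ∃ (V : C) (f : X ⟶ V) (p : image f ⟶ Y) (s : Y ⟶ image f),
        Q V f ∧ s ≫ p = 𝟙 Y ∧ factorThruImage f ≫ p = q
    have hR : ∀ (T : C) (g : T ⟶ X), (∀ V f, R V f → g ≫ f = 0) → g = 0 := by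
      intro T g hg
      apply hQ
      intro V f hf
      by_contra hne
      have h1 : g ≫ factorThruImage f ≠ 0 := by
        intro h0
        apply hne
        rw [← image.fac f, reassoc_of% h0, zero_comp]
      obtain ⟨Y, p, s, hY, hsp, hp⟩ := exists_indec_retract hlen _ (image f) T _ rfl h1
      apply hp
      rw [Category.assoc]
      exact hg Y _ ⟨hY, V, f, p, s, hf, hsp, rfl⟩
    have hRle : ∀ V f, R V f → ∀ (Z : C) (m : Z ⟶ V), Mono m → Indecomposable Z →
        lexLE (mu Z) (mu X) := by
      rintro Y q ⟨hY, V, f, p, s, hf, hsp, rfl⟩ Z m hm hZ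
      have : IsSplitMono s := ⟨⟨⟨p, hsp⟩⟩⟩
      exact hle V f hf Z (m ≫ s ≫ image.ι f) inferInstance hZ
    have hRlen : ∀ Y q, R Y q → len Y < len X := by
      rintro Y q ⟨hY, V, f, p, s, hf, hsp, rfl⟩
      have : IsSplitEpi p := ⟨⟨⟨s, hsp⟩⟩⟩
      apply len_lt_of_epi hlen (factorThruImage f ≫ p)
      intro hmono
      apply hcon V f hf
      have := mono_of_mono (factorThruImage f) p
      rw [← image.fac f]
      infer_instance
    rcases exists_pred hlen hmu hX with h1 | ⟨X', j, S, hj, hji, hX', hS, hSle⟩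
    · have : ∃ Y q, R Y q := by
        by_contra hno
        push Not at hno
        apply hX.1
        rw [IsZero.iff_id_eq_zero]
        exact hR _ _ (fun V f h => absurd h (hno V f))
      obtain ⟨Y, q, hYq⟩ := this
      have h2 := hRle Y q hYq Y (𝟙 Y) inferInstance hYq.1
      have h3 := hRlen Y q hYq
      rw [h1, lexLE_iff'] at h2
      obtain ⟨b, hb, -, hlt⟩ := h2 (len Y) (len_mem_mu hlen hmu hYq.1) (by simp; omega)
      simp at hb
      omega
    · have hR'le : ∀ V f, R V f → ∀ (Z : C) (m : Z ⟶ V), Mono m → Indecomposable Z →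
          lexLE (mu Z) (mu X') := by
        intro V f hf Z m hm hZ
        refine lex_comb (n := len X) ?_ (hS ▸ hRle V f hf Z m hm hZ) hSle
        intro b hb
        have h1 := mu_le_len hlen hmu hZ b hb
        have h2 := len_le_of_mono hlen m
        have h3 := hRlen V f hf
        omega
      obtain ⟨Y, q', ⟨q, hq, rfl⟩, hmono⟩ := ih (len X') (hn ▸ len_lt_of_mono hlen j hji) X'
        (fun Y q' => ∃ q, R Y q ∧ j ≫ q = q') rfl hX'
        (by
          intro T g hg
          have : g ≫ j = 0 := hR _ _ (fun V f h => by
            rw [Category.assoc]; exact hg V _ ⟨f, h, rfl⟩)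
          exact zero_of_comp_mono j this)
        (by
          rintro V _ ⟨f, hf, rfl⟩
          exact hR'le V f hf)
      have hiso := isIso_of_mu_le hlen hmu hX' hq.1 (j ≫ q)
        (hR'le Y q hq Y (𝟙 Y) inferInstance hq.1)
      exact hji (isIso_of_retract hX hX'.1 j (q ≫ inv (j ≫ q)) (by
        rw [← Category.assoc]; simp))

end GR

/-- If `X` is a Gabriel-Roiter predecessor of `Y` and `φ : X ⟶ X̄` is a left
almost split morphism, then `Y` is an epimorphic image of `X̄`. -/
theorem grPred_quotient_of_leftAlmostSplit
    (len : C → ℕ) (hlen : ∀ Z : C, ObjLength Z (len Z))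
    (mu : C → Finset ℕ) (hmu : IsGRMeasure len mu)
    (X Y Xbar : C) (hpred : IsGRPred mu X Y)
    (φ : X ⟶ Xbar)
    (hns : ¬ ∃ r : Xbar ⟶ X, φ ≫ r = 𝟙 X)
    (hfac : ∀ (V : C) (ψ : X ⟶ V), (¬ ∃ r : V ⟶ X, ψ ≫ r = 𝟙 X) →
      ∃ h : Xbar ⟶ V, φ ≫ h = ψ) :
    ∃ g : Xbar ⟶ Y, Epi g := by
  obtain ⟨hX, hY, ⟨ψ, hψ, hψi⟩, hmax⟩ := hpred
  obtain ⟨h, hh⟩ := hfac Y ψ (by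
    rintro ⟨r, hr⟩
    exact hψi (isIso_of_retract hY hX.1 ψ r hr))
  refine ⟨h, ?_⟩
  by_contra hepi
  have hmax' : ∀ (Z : C) (m : Z ⟶ Y), Mono m → ¬ IsIso m → Indecomposable Z →
      lexLE (mu Z) (mu X) := by
    intro Z m hm hmi hZ
    have e := Subobject.underlyingIso m
    have hI := indec_of_iso e.symm hZ
    refine lexLE_trans' (mu_mono hlen hmu hZ hI e.inv) (hmax _ ?_ hI)
    intro ht
    exact hmi ((Subobject.isIso_iff_mk_eq_top m).2 ht)
  let u : X ⟶ image h := φ ≫ factorThruImage h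
  have hu : u ≫ image.ι h = ψ := by simp [u, hh]
  have hum : Mono u := by
    have : Mono (u ≫ image.ι h) := hu ▸ hψ
    exact mono_of_mono u (image.ι h)
  let Q : ∀ V : C, (X ⟶ V) → Prop := fun V f =>
    Indecomposable V ∧ ∃ (p : image h ⟶ V) (s : V ⟶ image h), s ≫ p = 𝟙 V ∧ u ≫ p = f
  have hQle : ∀ V f, Q V f → ∀ (Z : C) (m : Z ⟶ V), Mono m → Indecomposable Z →
        lexLE (mu Z) (mu X) := by
    rintro V _ ⟨hV, p, s, hsp, rfl⟩ Z m hm hZ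
    have : IsSplitMono s := ⟨⟨⟨p, hsp⟩⟩⟩
    refine hmax' Z ((m ≫ s) ≫ image.ι h) inferInstance ?_ hZ
    intro hi
    apply hepi
    have : Epi (image.ι h) := epi_of_epi (m ≫ s) _
    rw [← image.fac h]
    infer_instance
  obtain ⟨V, f, hVf, hf⟩ := main_property hlen hmu _ X Q rfl hX (by
      intro T g hg
      by_contra hne
      have h1 : g ≫ u ≠ 0 := fun h0 => hne (zero_of_comp_mono u h0)
      obtain ⟨V, p, s, hV, hsp, hp⟩ := exists_indec_retract hlen _ _ T _ rfl h1
      apply hp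
      rw [Category.assoc]
      exact hg V _ ⟨hV, p, s, hsp, rfl⟩) hQle
  have hiso := isIso_of_mu_le hlen hmu hX hVf.1 f (hQle V f hVf V (𝟙 V) inferInstance hVf.1)
  obtain ⟨hV, p, s, hsp, rfl⟩ := hVf
  apply hns
  refine ⟨factorThruImage h ≫ p ≫ inv (u ≫ p), ?_⟩
  have := IsIso.hom_inv_id (u ≫ p)
  simpa only [u, Category.assoc] using this
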